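/- arXiv:1407.7978 — 2 statements merged into one kernel-verified Lean document; each statement's English description precedes it below -/
import Mathlib

section
/- Let B₁ be the open unit ball in ℝ^{n+1} centered at the origin. Let L be the operator L(u) = Σ_{i,j=1}^{n+1} a_{ij}(x) ∂_{ij} u + Σ_{i=1}^{n} b_i(x) ∂_i u + (a(x)/x_{n+1}) ∂_{n+1} u, where the coefficients a_{ij}, b_i, a are continuous on ℝ^{n+1}, a(x) ≥ 0, and the matrix (a_{ij}(x)) is positive definite at every point. Suppose u ∈ C²(B₁) ∩ C(closure of B₁) satisfies ∂_{n+1} u(x′, 0) = 0 for all (x′,0) ∈ B₁ and −L(u) ≥ 0 in B₁ (on {x_{n+1}=0} the singular term is interpreted by its continuous extension). Then either u is constant or u does not attain its minimum over the closed ball at any interior point of B₁. -/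
open MeasureTheory Metric Filter Function Topology

/-- First-order partial derivative in the `i`-th coordinate direction. -/
noncomputable def pderiv' {m : ℕ} (i : Fin m) (f : EuclideanSpace ℝ (Fin m) → ℝ)
    (x : EuclideanSpace ℝ (Fin m)) : ℝ :=
  fderiv ℝ f x (EuclideanSpace.single i 1)

/-- The operator `L(u) = Σ_{i,j} a_{ij}(x) ∂_{ij} u + Σ_{i=1}^n b_i(x) ∂_i u
+ (a(x)/x_{n+1}) ∂_{n+1} u`; on `{x_{n+1} = 0}` the singular term is interpreted by its
continuous extension (for `u` with `∂_{n+1} u(x',0) = 0` this is `a(x) ∂_{n+1,n+1} u`). -/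
noncomputable def opL (n : ℕ)
    (A : EuclideanSpace ℝ (Fin (n + 1)) → Matrix (Fin (n + 1)) (Fin (n + 1)) ℝ)
    (b : EuclideanSpace ℝ (Fin (n + 1)) → Fin n → ℝ)
    (c : EuclideanSpace ℝ (Fin (n + 1)) → ℝ)
    (u : EuclideanSpace ℝ (Fin (n + 1)) → ℝ) (x : EuclideanSpace ℝ (Fin (n + 1))) : ℝ :=
  (∑ i, ∑ j, A x i j * pderiv' i (pderiv' j u) x) +
    (∑ i : Fin n, b x i * pderiv' (Fin.castSucc i) u x) +
    (if x (Fin.last n) = 0 then c x * pderiv' (Fin.last n) (pderiv' (Fin.last n) u) x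
     else (c x / x (Fin.last n)) * pderiv' (Fin.last n) u x)


theorem oneD_first {g : ℝ → ℝ} {d : ℝ} (hg : HasDerivAt g d 0)
    (hmin : ∀ᶠ t in 𝓝[>] (0:ℝ), g 0 ≤ g t) : 0 ≤ d := by
  have h := (hasDerivAt_iff_tendsto_slope.1 hg).mono_left
    (nhdsWithin_mono (0:ℝ) (fun x (hx : x ∈ Set.Ioi (0:ℝ)) => (ne_of_gt hx : x ≠ 0)))
  refine ge_of_tendsto h ?_
  filter_upwards [hmin, self_mem_nhdsWithin] with t ht h0
  have h0' : (0:ℝ) < t := h0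
  rw [slope_def_field]
  exact div_nonneg (by linarith) (by linarith)

theorem oneD_second {g g' : ℝ → ℝ} {d : ℝ} (hg : ∀ᶠ t in 𝓝 (0:ℝ), HasDerivAt g (g' t) t)
    (hg' : HasDerivAt g' d 0) (h0 : g' 0 = 0)
    (hmin : ∀ᶠ t in 𝓝[>] (0:ℝ), g 0 ≤ g t) : 0 ≤ d := by
  by_contra! hd
  have h := (hasDerivAt_iff_tendsto_slope.1 hg').mono_left
    (nhdsWithin_mono (0:ℝ) (fun x (hx : x ∈ Set.Ioi (0:ℝ)) => (ne_of_gt hx : x ≠ 0)))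
  have hneg : ∀ᶠ t in 𝓝[>] (0:ℝ), g' t < 0 := by
    filter_upwards [h.eventually_lt_const hd, self_mem_nhdsWithin] with t ht h1
    have h1' : (0:ℝ) < t := h1
    rw [slope_def_field, h0, div_lt_iff₀ (by linarith)] at ht
    linarith
  have hall := (hneg.and hmin).and (hg.filter_mono nhdsWithin_le_nhds)
  obtain ⟨δ, hδ, hall⟩ := mem_nhdsGT_iff_exists_Ioc_subset.1 hall
  have hδ' : (0:ℝ) < δ := hδ
  have hg0 : HasDerivAt g (g' 0) 0 := hg.self_of_nhds
  obtain ⟨t, ht, hs⟩ := exists_hasDerivAt_eq_slope g g' hδ'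
    (by
      intro t ht
      rcases eq_or_lt_of_le ht.1 with h | h
      · rw [← h]; exact hg0.continuousAt.continuousWithinAt
      · exact (hall ⟨h, ht.2⟩).2.continuousAt.continuousWithinAt)
    (fun t ht => (hall ⟨ht.1, ht.2.le⟩).2)
  have h1 := (hall ⟨ht.1, ht.2.le⟩).1.1
  have h2 := (hall ⟨hδ', le_refl _⟩).1.2
  rw [hs] at h1
  have : 0 ≤ (g δ - g 0) / (δ - 0) := div_nonneg (by linarith) (by linarith)
  linarith

theorem fderiv_eq_sum {m : ℕ} (f : EuclideanSpace ℝ (Fin m) → ℝ) (x ξ : EuclideanSpace ℝ (Fin m)) :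
    fderiv ℝ f x ξ = ∑ i, ξ i * pderiv' i f x := by
  have : ξ = ∑ i, ξ i • EuclideanSpace.single i (1:ℝ) := by
    ext j
    simp [Finset.sum_apply, Pi.single_apply]
  conv_lhs => rw [this]
  simp [pderiv', map_sum]

theorem contDiffAt_pderiv' {m : ℕ} (i : Fin m) {f : EuclideanSpace ℝ (Fin m) → ℝ}
    {x : EuclideanSpace ℝ (Fin m)} (hf : ContDiffAt ℝ 2 f x) :
    ContDiffAt ℝ 1 (pderiv' i f) x := by
  have h : ContDiffAt ℝ 1 (fderiv ℝ f) x := hf.fderiv_right (by norm_num)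
  exact h.clm_apply contDiffAt_const

theorem hasDerivAt_line {m : ℕ} {f : EuclideanSpace ℝ (Fin m) → ℝ}
    (x ξ : EuclideanSpace ℝ (Fin m)) (t : ℝ) (hf : DifferentiableAt ℝ f (x + t • ξ)) :
    HasDerivAt (fun t : ℝ => f (x + t • ξ)) (∑ i, ξ i * pderiv' i f (x + t • ξ)) t := by
  rw [← fderiv_eq_sum]
  have h1 : HasDerivAt (fun t : ℝ => x + t • ξ) ξ t := by
    simpa using ((hasDerivAt_id t).smul_const ξ).const_add x
  exact hf.hasFDerivAt.comp_hasDerivAt t h1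

theorem tendsto_line {m : ℕ} (x ξ : EuclideanSpace ℝ (Fin m)) :
    Tendsto (fun t : ℝ => x + t • ξ) (𝓝 0) (𝓝 x) := by
  have : Continuous (fun t : ℝ => x + t • ξ) := by fun_prop
  simpa using this.tendsto 0

theorem line_second {m : ℕ} {f : EuclideanSpace ℝ (Fin m) → ℝ}
    (x ξ : EuclideanSpace ℝ (Fin m)) (hf : ContDiffAt ℝ 2 f x) (h0 : fderiv ℝ f x = 0)
    (hmin : ∀ᶠ t in 𝓝[>] (0:ℝ), f x ≤ f (x + t • ξ)) :
    0 ≤ ∑ i, ∑ j, ξ i * ξ j * pderiv' i (pderiv' j f) x := by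
  have hev : ∀ᶠ y in 𝓝 x, ContDiffAt ℝ 2 f y := hf.eventually (by simp)
  have key := oneD_second (g := fun t : ℝ => f (x + t • ξ))
    (g' := fun t : ℝ => ∑ j, ξ j * pderiv' j f (x + t • ξ))
    (d := ∑ j, ξ j * ∑ i, ξ i * pderiv' i (pderiv' j f) x) ?_ ?_ ?_ ?_
  · rw [Finset.sum_comm]
    convert key using 2 with j
    rw [Finset.mul_sum]
    exact Finset.sum_congr rfl fun i _ => by ring
  · filter_upwards [(tendsto_line x ξ).eventually hev] with t ht
    exact hasDerivAt_line x ξ t (ht.differentiableAt (by norm_num))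
  · refine HasDerivAt.fun_sum fun j _ => HasDerivAt.const_mul _ ?_
    have := hasDerivAt_line (f := pderiv' j f) x ξ 0
      (by simpa using (contDiffAt_pderiv' j hf).differentiableAt (by norm_num))
    simpa using this
  · have := fderiv_eq_sum f x ξ
    rw [h0] at this
    simpa using this.symm
  · simpa using hmin

theorem line_first {m : ℕ} {f : EuclideanSpace ℝ (Fin m) → ℝ}
    (x ξ : EuclideanSpace ℝ (Fin m)) (hf : DifferentiableAt ℝ f x)
    (hmin : ∀ᶠ t in 𝓝[>] (0:ℝ), f x ≤ f (x + t • ξ)) :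
    0 ≤ fderiv ℝ f x ξ := by
  have := hasDerivAt_line x ξ 0 (by simpa using hf)
  rw [← fderiv_eq_sum] at this
  have := oneD_first this (by simpa using hmin)
  simpa using this

open scoped MatrixOrder ComplexOrder in
theorem trace_nonneg {m : ℕ} {A H : Matrix (Fin m) (Fin m) ℝ} (hA : A.PosDef)
    (hH : ∀ ξ : Fin m → ℝ, 0 ≤ ∑ i, ∑ j, ξ i * ξ j * H i j) :
    0 ≤ ∑ i, ∑ j, A i j * H i j := by
  obtain ⟨B, hB⟩ := CStarAlgebra.nonneg_iff_eq_star_mul_self.mp hA.posSemidef.nonneg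
  have e : ∑ i, ∑ j, A i j * H i j = ∑ k, ∑ i, ∑ j, B k i * B k j * H i j := by
    rw [Finset.sum_comm (s := Finset.univ) (t := Finset.univ)
      (f := fun k i => ∑ j, B k i * B k j * H i j)]
    refine Finset.sum_congr rfl fun i _ => ?_
    rw [Finset.sum_comm]
    refine Finset.sum_congr rfl fun j _ => ?_
    rw [hB, Matrix.mul_apply, Finset.sum_mul]
    exact Finset.sum_congr rfl fun k _ => by simp [Matrix.star_apply]
  rw [e]
  exact Finset.sum_nonneg fun k _ => hH (B k)

/-- Second-order test for a minimum on a half space. -/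
theorem opL_nonneg_of_min (n : ℕ)
    (A : EuclideanSpace ℝ (Fin (n + 1)) → Matrix (Fin (n + 1)) (Fin (n + 1)) ℝ)
    (b : EuclideanSpace ℝ (Fin (n + 1)) → Fin n → ℝ)
    (c : EuclideanSpace ℝ (Fin (n + 1)) → ℝ)
    (hc0 : ∀ x, 0 ≤ c x)
    (hposdef : ∀ x, (A x).PosDef)
    (v : EuclideanSpace ℝ (Fin (n + 1)) → ℝ) (x : EuclideanSpace ℝ (Fin (n + 1)))
    (hv : ContDiffAt ℝ 2 v x) (s : ℝ) (hx : 0 ≤ s * x (Fin.last n)) (hs : s ≠ 0)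
    (hmin : ∀ᶠ y in 𝓝 x, 0 ≤ s * y (Fin.last n) → v x ≤ v y)
    (hN : x (Fin.last n) = 0 → pderiv' (Fin.last n) v x = 0) : 0 ≤ opL n A b c v x := by
  have hd : DifferentiableAt ℝ v x := hv.differentiableAt (by norm_num)
  have hadm : ∀ ξ : EuclideanSpace ℝ (Fin (n + 1)), 0 ≤ s * ξ (Fin.last n) →
      ∀ᶠ t in 𝓝[>] (0:ℝ), v x ≤ v (x + t • ξ) := by
    intro ξ hξ
    filter_upwards [((tendsto_line x ξ).eventually hmin).filter_mono nhdsWithin_le_nhds,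
      self_mem_nhdsWithin] with t ht h0
    have h0' : (0:ℝ) < t := h0
    apply ht
    have : s * (x + t • ξ) (Fin.last n) = s * x (Fin.last n) + t * (s * ξ (Fin.last n)) := by
      simp; ring
    rw [this]; positivity
  have hgrad : fderiv ℝ v x = 0 := by
    by_cases hx0 : x (Fin.last n) = 0
    · ext ξ
      have h1 : ∀ η : EuclideanSpace ℝ (Fin (n + 1)), η (Fin.last n) = 0 → fderiv ℝ v x η = 0 := by
        intro η hη
        have h1 := line_first x η hd (hadm η (by simp [hη]))
        have h2 := line_first x (-η) hd (hadm (-η) (by simp [hη]))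
        rw [map_neg] at h2
        linarith
      have h2 := h1 (ξ - ξ (Fin.last n) • EuclideanSpace.single (Fin.last n) 1) (by simp)
      have h3 := hN hx0
      unfold pderiv' at h3
      rw [map_sub, map_smul, h3] at h2
      simpa using h2
    · have hpos : 0 < s * x (Fin.last n) := lt_of_le_of_ne hx (Ne.symm (mul_ne_zero hs hx0))
      have hcont : Continuous (fun y : EuclideanSpace ℝ (Fin (n + 1)) => s * y (Fin.last n)) := by
        fun_prop
      have : IsLocalMin v x := by
        filter_upwards [hmin, hcont.continuousAt.eventually (lt_mem_nhds hpos)] with y h1 h2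
        exact h1 h2.le
      exact this.fderiv_eq_zero
  have hH : ∀ ξ : Fin (n + 1) → ℝ, 0 ≤ ∑ i, ∑ j, ξ i * ξ j * pderiv' i (pderiv' j v) x := by
    intro ξ
    by_cases h : 0 ≤ s * ξ (Fin.last n)
    · simpa using line_second x (WithLp.toLp 2 ξ) hv hgrad (hadm _ (by simpa using h))
    · simpa using line_second x (-WithLp.toLp 2 ξ) hv hgrad
        (hadm _ (by simp; linarith))
  have hp : ∀ i, pderiv' i v x = 0 := fun i => by simp [pderiv', hgrad]
  have h1 := trace_nonneg (H := Matrix.of fun i j => pderiv' i (pderiv' j v) x) (hposdef x)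
    (by simpa using hH)
  have h2 := hH (Pi.single (Fin.last n) 1)
  simp only [Matrix.of_apply] at h1
  unfold opL
  simp only [hp, mul_zero, Finset.sum_const_zero, add_zero]
  refine add_nonneg h1 ?_
  split_ifs
  · refine mul_nonneg (hc0 x) ?_
    simpa [Pi.single_apply] using h2
  · exact le_refl _

theorem opL_sub (n : ℕ)
    (A : EuclideanSpace ℝ (Fin (n + 1)) → Matrix (Fin (n + 1)) (Fin (n + 1)) ℝ)
    (b : EuclideanSpace ℝ (Fin (n + 1)) → Fin n → ℝ)
    (c : EuclideanSpace ℝ (Fin (n + 1)) → ℝ)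
    (u w : EuclideanSpace ℝ (Fin (n + 1)) → ℝ) (ε : ℝ) (x : EuclideanSpace ℝ (Fin (n + 1)))
    (hu : ContDiffAt ℝ 2 u x) (hw : ContDiffAt ℝ 2 w x) :
    opL n A b c (fun y => u y - ε * w y) x = opL n A b c u x - ε * opL n A b c w x := by
  have h1 : ∀ i (f g : EuclideanSpace ℝ (Fin (n + 1)) → ℝ) y, DifferentiableAt ℝ f y →
      DifferentiableAt ℝ g y → pderiv' i (fun y => f y - ε * g y) y
        = pderiv' i f y - ε * pderiv' i g y := by
    intro i f g y hf hg
    unfold pderiv'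
    rw [fderiv_fun_sub hf (hg.const_mul ε), fderiv_const_mul hg]
    simp
  have h2 : ∀ i, pderiv' i (fun y => u y - ε * w y) =ᶠ[𝓝 x]
      fun y => pderiv' i u y - ε * pderiv' i w y := by
    intro i
    filter_upwards [hu.eventually (by simp), hw.eventually (by simp)] with y hy1 hy2
    exact h1 i u w y (hy1.differentiableAt (by norm_num)) (hy2.differentiableAt (by norm_num))
  have h3 : ∀ i j, pderiv' i (pderiv' j (fun y => u y - ε * w y)) x =
      pderiv' i (pderiv' j u) x - ε * pderiv' i (pderiv' j w) x := by
    intro i j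
    rw [← h1 i _ _ x ((contDiffAt_pderiv' j hu).differentiableAt (by norm_num))
      ((contDiffAt_pderiv' j hw).differentiableAt (by norm_num))]
    have h4 := (h2 j).fderiv_eq (𝕜 := ℝ)
    exact congrArg (fun l => l (EuclideanSpace.single i 1)) h4
  unfold opL
  simp only [h3, fun i => (h2 i).self_of_nhds, mul_sub, Finset.sum_sub_distrib]
  have e1 : ∑ i, ∑ j, A x i j * (ε * pderiv' i (pderiv' j w) x) =
      ε * ∑ i, ∑ j, A x i j * pderiv' i (pderiv' j w) x := by
    simp only [Finset.mul_sum]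
    exact Finset.sum_congr rfl fun i _ => Finset.sum_congr rfl fun j _ => by ring
  have e2 : ∑ i : Fin n, b x i * (ε * pderiv' (Fin.castSucc i) w x) =
      ε * ∑ i : Fin n, b x i * pderiv' (Fin.castSucc i) w x := by
    simp only [Finset.mul_sum]
    exact Finset.sum_congr rfl fun i _ => by ring
  rw [e1, e2]
  split_ifs <;> ring

/-- The Hopf barrier. -/
noncomputable def barW {m : ℕ} (α : ℝ) (p : EuclideanSpace ℝ (Fin m))
    (x : EuclideanSpace ℝ (Fin m)) : ℝ := Real.exp (-α * ‖x - p‖ ^ 2)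

theorem barW_contDiff {m : ℕ} (α : ℝ) (p : EuclideanSpace ℝ (Fin m)) :
    ContDiff ℝ 2 (barW α p) := by
  unfold barW
  exact (contDiff_const.mul ((contDiff_id.sub contDiff_const).norm_sq ℝ)).exp

theorem barW_fderiv {m : ℕ} (α : ℝ) (p x ξ : EuclideanSpace ℝ (Fin m)) :
    fderiv ℝ (barW α p) x ξ = -2 * α * inner ℝ (x - p) ξ * barW α p x := by
  have h1 : HasFDerivAt (fun x : EuclideanSpace ℝ (Fin m) => x - p)
    (ContinuousLinearMap.id ℝ _) x := (hasFDerivAt_id x).sub_const p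
  have h := ((h1.norm_sq).const_mul (-α)).exp
  have h' : fderiv ℝ (barW α p) x = _ := h.fderiv
  rw [h']
  simp [barW, inner_sub_left]
  ring

theorem barW_p1 {m : ℕ} (α : ℝ) (p x : EuclideanSpace ℝ (Fin m)) (i : Fin m) :
    pderiv' i (barW α p) x = -2 * α * (x i - p i) * barW α p x := by
  unfold pderiv'
  rw [barW_fderiv]
  simp [EuclideanSpace.inner_single_right]

theorem barW_p2 {m : ℕ} (α : ℝ) (p x : EuclideanSpace ℝ (Fin m)) (i j : Fin m) :
    pderiv' i (pderiv' j (barW α p)) x =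
      (4 * α ^ 2 * ((x i - p i) * (x j - p j)) - 2 * α * (if i = j then 1 else 0)) * barW α p x := by
  have e : pderiv' j (barW α p) = fun x => (-2 * α * (x j - p j)) * barW α p x := by
    funext x; exact barW_p1 α p x j
  rw [e]
  have h1 : HasFDerivAt (fun x : EuclideanSpace ℝ (Fin m) => -2 * α * (x j - p j))
      ((-2 * α) • (EuclideanSpace.proj j : EuclideanSpace ℝ (Fin m) →L[ℝ] ℝ)) x :=
    (((EuclideanSpace.proj j : EuclideanSpace ℝ (Fin m) →L[ℝ] ℝ).hasFDerivAt).sub_const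
      (p j)).const_mul (-2 * α)
  have h2 : HasFDerivAt (barW α p) (fderiv ℝ (barW α p) x) x :=
    ((barW_contDiff α p).differentiable (by norm_num) x).hasFDerivAt
  have h3 := (h1.mul h2).fderiv
  have h4 := barW_p1 α p x i
  unfold pderiv' at h4 ⊢
  rw [show (fun x => (-2 * α * (x j - p j)) * barW α p x) = 
    (fun x : EuclideanSpace ℝ (Fin m) => -2 * α * (x j - p j)) * barW α p from rfl, h3]
  simp only [add_apply, smul_apply, smul_eq_mul, h4]
  by_cases hij : i = j
  · subst hij; simp; ring
  · simp [hij, Ne.symm hij]; ring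

theorem barrier (n : ℕ)
    (A : EuclideanSpace ℝ (Fin (n + 1)) → Matrix (Fin (n + 1)) (Fin (n + 1)) ℝ)
    (b : EuclideanSpace ℝ (Fin (n + 1)) → Fin n → ℝ)
    (c : EuclideanSpace ℝ (Fin (n + 1)) → ℝ)
    (hA : ∀ i j, Continuous fun x => A x i j)
    (hb : ∀ i, Continuous fun x => b x i)
    (hc : Continuous c) (hc0 : ∀ x, 0 ≤ c x)
    (hposdef : ∀ x, (A x).PosDef)
    (p : EuclideanSpace ℝ (Fin (n + 1))) (r : ℝ) (hr : 0 < r) (s : ℝ) (hs : s ≠ 0)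
    (hp : 0 ≤ s * p (Fin.last n)) :
    ∃ α > 0, ∀ x, r / 2 ≤ dist x p → dist x p ≤ r → 0 ≤ s * x (Fin.last n) →
      0 < opL n A b c (barW α p) x := by
  let Q : EuclideanSpace ℝ (Fin (n + 1)) → ℝ := fun x =>
    ∑ i, ∑ j, A x i j * ((x i - p i) * (x j - p j))
  let G : EuclideanSpace ℝ (Fin (n + 1)) → ℝ := fun x =>
    (∑ i, A x i i) + (∑ i : Fin n, b x i * (x (Fin.castSucc i) - p (Fin.castSucc i))) + c x
  have hQc : Continuous Q := by
    refine continuous_finsetSum _ fun i _ => continuous_finsetSum _ fun j _ => ?_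
    exact (hA i j).mul (by fun_prop)
  have hGc : Continuous G := by
    refine ((continuous_finsetSum _ fun i _ => hA i i).add
      (continuous_finsetSum _ fun i _ => ?_)).add hc
    exact (hb i).mul (by fun_prop)
  let K : Set (EuclideanSpace ℝ (Fin (n + 1))) := closedBall p r ∩ {x | r / 2 ≤ dist x p}
  have hK : IsCompact K := (isCompact_closedBall p r).inter_right
    (isClosed_le continuous_const (by fun_prop))
  have hQpos : ∀ x ∈ K, 0 < Q x := by
    intro x hx
    have hne : x - p ≠ 0 := by
      intro h
      have h2 : r / 2 ≤ dist x p := hx.2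
      rw [dist_eq_norm, h, norm_zero] at h2
      linarith
    have := (hposdef x).dotProduct_mulVec_pos (x := fun i => x i - p i) (by
      intro h; apply hne; ext i; simpa using congrFun h i)
    simp only [dotProduct, Matrix.mulVec, star_trivial, Finset.mul_sum] at this
    refine lt_of_lt_of_eq this ?_
    exact Finset.sum_congr rfl fun i _ => Finset.sum_congr rfl fun j _ => by ring
  obtain ⟨lam, hlam, hQlam⟩ : ∃ lam > 0, ∀ x ∈ K, lam ≤ Q x := by
    rcases K.eq_empty_or_nonempty with h | h
    · exact ⟨1, one_pos, by simp [h]⟩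
    · obtain ⟨y, hy, hmin⟩ := hK.exists_isMinOn h hQc.continuousOn
      exact ⟨Q y, hQpos y hy, fun x hx => hmin hx⟩
  obtain ⟨C, hC⟩ := hK.exists_bound_of_continuousOn hGc.continuousOn
  refine ⟨(|C| + 1) / lam, by positivity, ?_⟩
  intro x hx1 hx2 hx3
  set α := (|C| + 1) / lam with hα
  have hαpos : 0 < α := by positivity
  have hαl : α * lam = |C| + 1 := by rw [hα]; field_simp
  have hxK : x ∈ K := ⟨hx2, hx1⟩
  have hw : 0 < barW α p x := Real.exp_pos _
  have hG : G x ≤ |C| := (le_abs_self _).trans ((hC x hxK).trans (le_abs_self C))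
  have hQ := hQlam x hxK
  have e1 : ∑ i, ∑ j, A x i j * pderiv' i (pderiv' j (barW α p)) x =
      (4 * α ^ 2 * Q x - 2 * α * ∑ i, A x i i) * barW α p x := by
    have hd : ∑ i, A x i i = ∑ i, ∑ j, A x i j * (if i = j then 1 else 0) := by simp
    rw [hd]
    simp only [barW_p2, Q]
    rw [Finset.mul_sum, Finset.mul_sum, ← Finset.sum_sub_distrib, Finset.sum_mul]
    refine Finset.sum_congr rfl fun i _ => ?_
    rw [Finset.mul_sum, Finset.mul_sum, ← Finset.sum_sub_distrib, Finset.sum_mul]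
    exact Finset.sum_congr rfl fun j _ => by ring
  have e2 : ∑ i : Fin n, b x i * pderiv' (Fin.castSucc i) (barW α p) x =
      -2 * α * (∑ i : Fin n, b x i * (x (Fin.castSucc i) - p (Fin.castSucc i))) * barW α p x := by
    simp only [barW_p1, Finset.mul_sum, Finset.sum_mul]
    exact Finset.sum_congr rfl fun i _ => by ring
  have e3 : -2 * α * c x * barW α p x ≤ (if x (Fin.last n) = 0 then
      c x * pderiv' (Fin.last n) (pderiv' (Fin.last n) (barW α p)) x
     else (c x / x (Fin.last n)) * pderiv' (Fin.last n) (barW α p) x) := by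
    split_ifs with h0
    · rw [barW_p2]
      simp only [if_true]
      have : 0 ≤ c x * (4 * α ^ 2 * ((x (Fin.last n) - p (Fin.last n)) ^ 2)) * barW α p x := by
        have := hc0 x
        positivity
      nlinarith
    · rw [barW_p1]
      have hq : 0 ≤ p (Fin.last n) / x (Fin.last n) := by
        have : p (Fin.last n) / x (Fin.last n) = (s * p (Fin.last n)) / (s * x (Fin.last n)) := by
          field_simp
        rw [this]; positivity
      have : c x / x (Fin.last n) * (-2 * α * (x (Fin.last n) - p (Fin.last n)) * barW α p x) =
        -2 * α * c x * barW α p x + 2 * α * c x * (p (Fin.last n) / x (Fin.last n)) * barW α p x := by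
        field_simp; ring
      rw [this]
      have : 0 ≤ 2 * α * c x * (p (Fin.last n) / x (Fin.last n)) * barW α p x := by
        have := hc0 x
        positivity
      linarith
  unfold opL
  rw [e1, e2]
  have hpos : 0 < 2 * α * (2 * α * Q x - G x) * barW α p x := by
    have : 0 < 2 * α * Q x - G x := by nlinarith [abs_nonneg C]
    positivity
  have : 2 * α * (2 * α * Q x - G x) * barW α p x =
    (4 * α ^ 2 * Q x - 2 * α * ∑ i, A x i i) * barW α p x +
    -2 * α * (∑ i : Fin n, b x i * (x (Fin.castSucc i) - p (Fin.castSucc i))) * barW α p x +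
    -2 * α * c x * barW α p x := by
    simp only [G]; ring
  linarith

theorem hopf (n : ℕ)
    (A : EuclideanSpace ℝ (Fin (n + 1)) → Matrix (Fin (n + 1)) (Fin (n + 1)) ℝ)
    (b : EuclideanSpace ℝ (Fin (n + 1)) → Fin n → ℝ)
    (c : EuclideanSpace ℝ (Fin (n + 1)) → ℝ)
    (hA : ∀ i j, Continuous fun x => A x i j)
    (hb : ∀ i, Continuous fun x => b x i)
    (hc : Continuous c) (hc0 : ∀ x, 0 ≤ c x)
    (hposdef : ∀ x, (A x).PosDef)
    (u : EuclideanSpace ℝ (Fin (n + 1)) → ℝ)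
    (hu2 : ContDiffOn ℝ 2 u (ball (0 : EuclideanSpace ℝ (Fin (n + 1))) 1))
    (hbd : ∀ x ∈ ball (0 : EuclideanSpace ℝ (Fin (n + 1))) 1, x (Fin.last n) = 0 →
      pderiv' (Fin.last n) u x = 0)
    (hL : ∀ x ∈ ball (0 : EuclideanSpace ℝ (Fin (n + 1))) 1, opL n A b c u x ≤ 0)
    (k : ℝ) (hk : ∀ x ∈ ball (0 : EuclideanSpace ℝ (Fin (n + 1))) 1, k ≤ u x)
    (p x0 : EuclideanSpace ℝ (Fin (n + 1))) (r : ℝ) (hr : 0 < r) (s : ℝ) (hs : s ≠ 0)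
    (hp : 0 ≤ s * p (Fin.last n)) (hx0 : 0 ≤ s * x0 (Fin.last n))
    (hsub : closedBall p r ⊆ ball (0 : EuclideanSpace ℝ (Fin (n + 1))) 1)
    (hdist : dist x0 p = r) (hux0 : u x0 = k)
    (hgt : ∀ y ∈ closedBall p r, y ≠ x0 → k < u y) : False := by
  obtain ⟨α, hα, hbar⟩ := barrier n A b c hA hb hc hc0 hposdef p r hr s hs hp
  have hu : ∀ x ∈ ball (0 : EuclideanSpace ℝ (Fin (n + 1))) 1, ContDiffAt ℝ 2 u x :=
    fun x hx => hu2.contDiffAt (isOpen_ball.mem_nhds hx)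
  have hw : ∀ x, ContDiffAt ℝ 2 (barW α p) x := fun x => (barW_contDiff α p).contDiffAt
  have hwc : Continuous (barW α p) := (barW_contDiff α p).continuous
  have hud : ∀ x ∈ ball (0 : EuclideanSpace ℝ (Fin (n + 1))) 1, DifferentiableAt ℝ u x :=
    fun x hx => (hu x hx).differentiableAt (by norm_num)
  have hwd : ∀ x, DifferentiableAt ℝ (barW α p) x :=
    fun x => (hw x).differentiableAt (by norm_num)
  have hwle : ∀ x, barW α p x ≤ 1 := by
    intro x
    unfold barW
    rw [Real.exp_le_one_iff]
    nlinarith [sq_nonneg ‖x - p‖]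
  have hwpos : ∀ x, 0 < barW α p x := fun x => Real.exp_pos _
  have hucont : ContinuousOn u (closedBall p r) := hu2.continuousOn.mono hsub
  have hx0B : x0 ∈ closedBall p r := by simp [hdist]
  -- gap on the inner sphere
  obtain ⟨δ, hδ, hgap⟩ : ∃ δ > 0, ∀ y, dist y p = r / 2 → k + δ ≤ u y := by
    have hss : sphere p (r / 2) ⊆ closedBall p r := by
      intro y hy
      rw [mem_sphere] at hy
      rw [mem_closedBall]; linarith
    rcases (sphere p (r / 2)).eq_empty_or_nonempty with h | h
    · refine ⟨1, one_pos, fun y hy => ?_⟩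
      have : y ∈ sphere p (r / 2) := hy
      rw [h] at this
      exact this.elim
    · obtain ⟨y, hy, hmin⟩ := (isCompact_sphere p (r / 2)).exists_isMinOn h (hucont.mono hss)
      have h1 : k < u y := hgt y (hss hy) (by
        rintro rfl
        rw [mem_sphere] at hy; linarith)
      refine ⟨u y - k, by linarith, fun z hz => ?_⟩
      have : u y ≤ u z := hmin (show z ∈ sphere p (r / 2) from hz)
      linarith
  set w0 : ℝ := Real.exp (-α * r ^ 2) with hw0
  have hw0pos : 0 < w0 := Real.exp_pos _
  have hwr : ∀ y, dist y p = r → barW α p y = w0 := by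
    intro y hy
    rw [dist_eq_norm] at hy
    simp [barW, hy, hw0]
  let v : EuclideanSpace ℝ (Fin (n + 1)) → ℝ := fun y => u y - δ * barW α p y
  have hvd : ∀ x ∈ ball (0 : EuclideanSpace ℝ (Fin (n + 1))) 1, ∀ ξ,
      fderiv ℝ v x ξ = fderiv ℝ u x ξ - δ * fderiv ℝ (barW α p) x ξ := by
    intro x hx ξ
    have : fderiv ℝ v x = _ := fderiv_fun_sub (hud x hx) ((hwd x).const_mul δ)
    rw [this, fderiv_const_mul (hwd x)]
    simp
  let D : Set (EuclideanSpace ℝ (Fin (n + 1))) :=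
    closedBall p r ∩ ({x | r / 2 ≤ dist x p} ∩ {x | 0 ≤ s * x (Fin.last n)})
  have hD : IsCompact D := (isCompact_closedBall p r).inter_right
    ((isClosed_le continuous_const (by fun_prop)).inter
      (isClosed_le continuous_const (by fun_prop)))
  have hx0D : x0 ∈ D := ⟨hx0B, by show r / 2 ≤ dist x0 p; linarith, hx0⟩
  have hvc : ContinuousOn v D :=
    (hucont.mono Set.inter_subset_left).sub (continuousOn_const.mul hwc.continuousOn)
  have hclaim : ∀ y ∈ D, k - δ * w0 ≤ v y := by
    obtain ⟨y, hy, hmin⟩ := hD.exists_isMinOn ⟨x0, hx0D⟩ hvc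
    suffices h : k - δ * w0 ≤ v y from fun z hz => h.trans (hmin hz)
    by_contra! hlt
    have hyB := hsub hy.1
    have hy1 : dist y p ≤ r := hy.1
    have hy2 : r / 2 ≤ dist y p := hy.2.1
    have hy3 : 0 ≤ s * y (Fin.last n) := hy.2.2
    have hne1 : dist y p ≠ r := by
      intro h
      have h1 : v y = u y - δ * w0 := by simp only [v]; rw [hwr y h]
      have := hk y hyB
      linarith
    have hne2 : r / 2 ≠ dist y p := by
      intro h
      have h1 := hgap y h.symm
      have h2 : δ * barW α p y ≤ δ * 1 := mul_le_mul_of_nonneg_left (hwle y) hδ.le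
      have h3 : 0 < δ * w0 := by positivity
      have h4 : v y = u y - δ * barW α p y := rfl
      linarith
    have hlt1 := lt_of_le_of_ne hy1 hne1
    have hlt2 := lt_of_le_of_ne hy2 hne2
    have hcd : Continuous (fun z : EuclideanSpace ℝ (Fin (n + 1)) => dist z p) := by fun_prop
    have hloc : ∀ᶠ z in 𝓝 y, 0 ≤ s * z (Fin.last n) → v y ≤ v z := by
      filter_upwards [hcd.continuousAt.eventually (gt_mem_nhds hlt1),
        hcd.continuousAt.eventually (lt_mem_nhds hlt2)] with z h1 h2 h3
      exact hmin (show z ∈ D from ⟨h1.le, h2.le, h3⟩)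
    have hvC : ContDiffAt ℝ 2 v y := (hu y hyB).sub (contDiffAt_const.mul (hw y))
    have hN : y (Fin.last n) = 0 → pderiv' (Fin.last n) v y = 0 := by
      intro h0
      have e1 : pderiv' (Fin.last n) v y = 2 * α * δ * barW α p y * (- p (Fin.last n)) := by
        have h1 := hvd y hyB (EuclideanSpace.single (Fin.last n) 1)
        have h2 := hbd y hyB h0
        have h3 := barW_p1 α p y (Fin.last n)
        unfold pderiv' at h2 h3 ⊢
        rw [h1, h2, h3, h0]; ring
      have h2 := line_first y (s • EuclideanSpace.single (Fin.last n) 1)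
        (hvC.differentiableAt (by norm_num)) (by
          filter_upwards [((tendsto_line y (s • EuclideanSpace.single (Fin.last n) 1)).eventually
            hloc).filter_mono nhdsWithin_le_nhds, self_mem_nhdsWithin] with t ht h0'
          have h0'' : (0:ℝ) < t := h0'
          apply ht
          have : s * (y + t • s • EuclideanSpace.single (Fin.last n) (1:ℝ)) (Fin.last n) =
            s ^ 2 * t := by simp [h0]; ring
          rw [this]; positivity)
      rw [map_smul] at h2
      change 0 ≤ s * pderiv' (Fin.last n) v y at h2
      rw [e1] at h2
      have hcpos : 0 < 2 * α * δ * barW α p y := by have := hwpos y; positivity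
      have h3 : s * p (Fin.last n) = 0 := by
        apply le_antisymm _ hp
        by_contra! h
        nlinarith [mul_pos hcpos h]
      have h4 : p (Fin.last n) = 0 := (mul_eq_zero.1 h3).resolve_left hs
      rw [e1, h4]; simp
    have h1 := opL_nonneg_of_min n A b c hc0 hposdef v y hvC s hy3 hs hloc hN
    have h2 : opL n A b c v y = _ := opL_sub n A b c u (barW α p) δ y (hu y hyB) (hw y)
    have h3 := hL y hyB
    have h4 := hbar y hy2 hy1 hy3
    have h5 : 0 < δ * opL n A b c (barW α p) y := by positivity
    linarith
  -- derivative at x0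
  have hx0ball := hsub hx0B
  have hgrad : fderiv ℝ u x0 = 0 := by
    have : IsLocalMin u x0 := by
      filter_upwards [isOpen_ball.mem_nhds hx0ball] with z hz
      rw [hux0]; exact hk z hz
    exact this.fderiv_eq_zero
  have hfin := line_first (f := v) x0 (p - x0)
    (((hu x0 hx0ball).sub (contDiffAt_const.mul (hw x0))).differentiableAt (by norm_num)) (by
      have hI : Set.Ioo (0:ℝ) (1/2) ∈ 𝓝[>] (0:ℝ) := Ioo_mem_nhdsGT (by norm_num)
      filter_upwards [hI] with t ht
      have hd : dist (x0 + t • (p - x0)) p = (1 - t) * r := by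
        have : x0 + t • (p - x0) - p = (1 - t) • (x0 - p) := by module
        rw [dist_eq_norm, this, norm_smul, ← dist_eq_norm x0 p, hdist, Real.norm_eq_abs,
          abs_of_pos (by linarith [ht.2])]
      have h1 := hclaim (x0 + t • (p - x0)) ⟨by
          rw [mem_closedBall, hd]; nlinarith [ht.1], by
          show r / 2 ≤ dist _ p
          rw [hd]; nlinarith [ht.2], by
          show 0 ≤ s * (x0 + t • (p - x0)) (Fin.last n)
          have : s * (x0 + t • (p - x0)) (Fin.last n) =
            (1 - t) * (s * x0 (Fin.last n)) + t * (s * p (Fin.last n)) := by simp; ring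
          rw [this]
          have := ht.1
          have : 0 < 1 - t := by linarith [ht.2]
          positivity⟩
      have h2 : v x0 = k - δ * w0 := by simp only [v]; rw [hux0, hwr x0 hdist]
      rw [h2]; exact h1)
  rw [hvd x0 hx0ball, hgrad, barW_fderiv, hwr x0 hdist] at hfin
  have hin : inner ℝ (x0 - p) (p - x0) = - r ^ 2 := by
    rw [← neg_sub x0 p, inner_neg_right, real_inner_self_eq_norm_sq, ← dist_eq_norm, hdist]
  rw [hin] at hfin
  have : 0 < 2 * α * δ * r ^ 2 * w0 := by positivity
  simp at hfin
  nlinarith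

theorem choose_sign (a d : ℝ) : ∃ s θ : ℝ, s ≠ 0 ∧ 0 < θ ∧ θ < 1 ∧ 0 ≤ s * a ∧
    0 ≤ s * (a + θ * (d - a)) := by
  by_cases ha : a = 0
  · subst ha
    rcases le_total 0 d with h | h
    · exact ⟨1, 1/2, by norm_num, by norm_num, by norm_num, by norm_num, by linarith⟩
    · exact ⟨-1, 1/2, by norm_num, by norm_num, by norm_num, by norm_num, by linarith⟩
  · have hc : Continuous (fun θ : ℝ => a * (a + θ * (d - a))) := by fun_prop
    have h0 : 0 < a * (a + 0 * (d - a)) := by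
      have := mul_self_pos.2 ha
      simpa using this
    have h1 : ∀ᶠ θ in 𝓝[>] (0:ℝ), 0 < a * (a + θ * (d - a)) :=
      (hc.continuousAt.eventually (lt_mem_nhds h0)).filter_mono nhdsWithin_le_nhds
    have hI : Set.Ioo (0:ℝ) 1 ∈ 𝓝[>] (0:ℝ) := Ioo_mem_nhdsGT (by norm_num)
    obtain ⟨θ, h2, h3⟩ := (h1.and hI).exists
    exact ⟨a, θ, ha, h3.1, h3.2, mul_self_nonneg a, h2.le⟩

theorem stmt_5 (n : ℕ)
    (A : EuclideanSpace ℝ (Fin (n + 1)) → Matrix (Fin (n + 1)) (Fin (n + 1)) ℝ)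
    (b : EuclideanSpace ℝ (Fin (n + 1)) → Fin n → ℝ)
    (c : EuclideanSpace ℝ (Fin (n + 1)) → ℝ)
    (hA : ∀ i j, Continuous fun x => A x i j)
    (hb : ∀ i, Continuous fun x => b x i)
    (hc : Continuous c) (hc0 : ∀ x, 0 ≤ c x)
    (hposdef : ∀ x, (A x).PosDef)
    (u : EuclideanSpace ℝ (Fin (n + 1)) → ℝ)
    (hu2 : ContDiffOn ℝ 2 u (ball (0 : EuclideanSpace ℝ (Fin (n + 1))) 1))
    (huc : ContinuousOn u (closedBall (0 : EuclideanSpace ℝ (Fin (n + 1))) 1))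
    (hbd : ∀ x ∈ ball (0 : EuclideanSpace ℝ (Fin (n + 1))) 1, x (Fin.last n) = 0 →
      pderiv' (Fin.last n) u x = 0)
    (hL : ∀ x ∈ ball (0 : EuclideanSpace ℝ (Fin (n + 1))) 1, opL n A b c u x ≤ 0) :
    (∃ k : ℝ, ∀ x ∈ closedBall (0 : EuclideanSpace ℝ (Fin (n + 1))) 1, u x = k) ∨
      ∀ x ∈ ball (0 : EuclideanSpace ℝ (Fin (n + 1))) 1,
        ¬ IsMinOn u (closedBall (0 : EuclideanSpace ℝ (Fin (n + 1))) 1) x := by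
  by_cases hex : ∃ x ∈ ball (0 : EuclideanSpace ℝ (Fin (n + 1))) 1,
      IsMinOn u (closedBall (0 : EuclideanSpace ℝ (Fin (n + 1))) 1) x
  swap
  · right
    intro x hx hmin
    exact hex ⟨x, hx, hmin⟩
  left
  obtain ⟨xm, hxm, hmin⟩ := hex
  refine ⟨u xm, ?_⟩
  set k := u xm with hkdef
  have hk : ∀ x ∈ ball (0 : EuclideanSpace ℝ (Fin (n + 1))) 1, k ≤ u x :=
    fun x hx => hmin (ball_subset_closedBall hx)
  have hub : ContinuousOn u (ball (0 : EuclideanSpace ℝ (Fin (n + 1))) 1) :=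
    huc.mono ball_subset_closedBall
  -- the set of minimum points is open
  have hopen : ∀ x1 ∈ ball (0 : EuclideanSpace ℝ (Fin (n + 1))) 1, u x1 = k →
      ∀ᶠ z in 𝓝 x1, u z = k := by
    intro x1 hx1 hux1
    rw [mem_ball_zero_iff] at hx1
    filter_upwards [ball_mem_nhds x1 (show 0 < (1 - ‖x1‖) / 2 by linarith)] with z hz
    rw [mem_ball] at hz
    by_contra hne
    have hzsub : closedBall z (dist z x1) ⊆ ball (0 : EuclideanSpace ℝ (Fin (n + 1))) 1 := by
      intro y hy
      rw [mem_closedBall] at hy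
      rw [mem_ball_zero_iff]
      have h1 : dist y x1 ≤ dist y z + dist z x1 := dist_triangle _ _ _
      have h2 : ‖y‖ ≤ ‖y - x1‖ + ‖x1‖ := by simpa using norm_add_le (y - x1) x1
      rw [← dist_eq_norm] at h2
      linarith
    have hKc : IsCompact (closedBall z (dist z x1) ∩ u ⁻¹' {k}) :=
      (isCompact_closedBall z (dist z x1)).of_isClosed_subset
        ((hub.mono hzsub).preimage_isClosed_of_isClosed isClosed_closedBall isClosed_singleton)
        Set.inter_subset_left
    obtain ⟨x0, ⟨hx0B, hux0⟩, hx0min⟩ := hKc.exists_isMinOn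
      ⟨x1, by rw [mem_closedBall, dist_comm], hux1⟩
      (show ContinuousOn (fun y => dist y z) _ by fun_prop)
    have hux0' : u x0 = k := hux0
    have hx0z : x0 ≠ z := by rintro rfl; exact hne hux0'
    have hfar : ∀ y, dist y z < dist x0 z → k < u y := by
      intro y hy
      rw [mem_closedBall] at hx0B
      have hyB : y ∈ closedBall z (dist z x1) := by rw [mem_closedBall]; linarith
      refine lt_of_le_of_ne (hk y (hzsub hyB)) ?_
      intro h
      have : dist x0 z ≤ dist y z := hx0min (show y ∈ _ from ⟨hyB, h.symm⟩)
      linarith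
    obtain ⟨s, θ, hs, hθ0, hθ1, hsx, hsp⟩ := choose_sign (x0 (Fin.last n)) (z (Fin.last n))
    have hR : 0 < dist x0 z := dist_pos.2 hx0z
    have hstrict : ∀ y ∈ closedBall (x0 + θ • (z - x0)) (θ * dist x0 z), y ≠ x0 →
        dist y z < dist x0 z := by
      intro y hy hyx
      rw [mem_closedBall, dist_eq_norm, dist_eq_norm] at hy
      rw [dist_eq_norm, dist_eq_norm]
      have e1 : y - (x0 + θ • (z - x0)) = (y - x0) - θ • (z - x0) := by module
      have e2 : y - z = (y - x0) - (z - x0) := by module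
      have e3 : ‖x0 - z‖ = ‖z - x0‖ := norm_sub_rev _ _
      rw [e1, e3] at hy
      rw [e2, e3]
      have hh : 0 < ‖y - x0‖ := norm_pos_iff.2 (sub_ne_zero.2 hyx)
      generalize y - x0 = h at hy hh ⊢
      generalize z - x0 = e at hy ⊢
      have h1 := norm_sub_sq_real h (θ • e)
      have h2 := norm_sub_sq_real h e
      rw [inner_smul_right, norm_smul, Real.norm_eq_abs, abs_of_pos hθ0] at h1
      have h3 : ‖h - θ • e‖ ^ 2 ≤ (θ * ‖e‖) ^ 2 := pow_le_pow_left₀ (norm_nonneg _) hy 2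
      have h4 : ‖h‖ ^ 2 ≤ θ * (2 * inner ℝ h e) := by linarith
      have h5 : ‖h‖ ^ 2 < 2 * inner ℝ h e := by
        have : 0 < ‖h‖ ^ 2 := by positivity
        nlinarith
      exact lt_of_pow_lt_pow_left₀ 2 (norm_nonneg _) (by linarith)
    refine hopf n A b c hA hb hc hc0 hposdef u hu2 hbd hL k hk (x0 + θ • (z - x0)) x0
      (θ * dist x0 z) (by positivity) s hs (by simpa using hsp) hsx ?_ ?_ hux0' ?_
    · intro y hy
      apply hzsub
      rw [mem_closedBall] at hx0B ⊢
      by_cases hyx : y = x0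
      · rw [hyx]; exact hx0B
      · exact (hstrict y hy hyx).le.trans hx0B
    · rw [dist_eq_norm, dist_eq_norm]
      have : x0 - (x0 + θ • (z - x0)) = θ • (x0 - z) := by module
      rw [this, norm_smul, Real.norm_eq_abs, abs_of_pos hθ0]
    · exact fun y hy hyx => hfar y (hstrict y hy hyx)
  -- connectedness
  have hball : ∀ x ∈ ball (0 : EuclideanSpace ℝ (Fin (n + 1))) 1, u x = k := by
    have hpre : IsPreconnected (ball (0 : EuclideanSpace ℝ (Fin (n + 1))) 1) :=
      (convex_ball _ _).isPreconnected
    have hU : IsOpen (interior {x | u x = k}) := isOpen_interior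
    have hV : IsOpen (ball (0 : EuclideanSpace ℝ (Fin (n + 1))) 1 ∩ u ⁻¹' Set.Ioi k) :=
      hub.isOpen_inter_preimage isOpen_ball isOpen_Ioi
    have := hpre.subset_left_of_subset_union hU hV ?_ ?_ ?_
    · intro x hx
      exact (interior_subset (this hx) : x ∈ {x | u x = k})
    · rw [Set.disjoint_left]
      rintro x hx ⟨_, hx2⟩
      have h1 : u x = k := (interior_subset hx : x ∈ {x | u x = k})
      have h2 : k < u x := hx2
      linarith
    · intro x hx
      rcases eq_or_lt_of_le (hk x hx) with h | h
      · exact Or.inl (mem_interior_iff_mem_nhds.2 (hopen x hx h.symm))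
      · exact Or.inr ⟨hx, h⟩
    · exact ⟨xm, hxm, mem_interior_iff_mem_nhds.2 (hopen xm hxm rfl)⟩
  intro x hx
  have hcl : closure (ball (0 : EuclideanSpace ℝ (Fin (n + 1))) 1) = closedBall 0 1 :=
    closure_ball _ one_ne_zero
  have : Set.EqOn u (fun _ => k) (closedBall (0 : EuclideanSpace ℝ (Fin (n + 1))) 1) := by
    refine Set.EqOn.of_subset_closure (s := ball 0 1) hball huc continuousOn_const
      ball_subset_closedBall hcl.symm.subset
  exact this hx
end

section
/- Let B₁ be the open unit ball in ℝ^{n+1} centered at the origin. Let L be the operator L(u) = Σ_{i,j=1}^{n+1} a_{ij}(x) ∂_{ij} u + Σ_{i=1}^{n} b_i(x) ∂_i u + (a(x)/x_{n+1}) ∂_{n+1} u, where the coefficients a_{ij}, b_i, a are continuous on ℝ^{n+1}, a(x) ≥ 0, and the matrix (a_{ij}(x)) is positive definite at every point. Suppose u ∈ C²(B₁) ∩ C¹(closure of B₁) satisfies ∂_{n+1} u(x′, 0) = 0 for all (x′,0) ∈ B₁ and −L(u) ≥ 0 in B₁ (on {x_{n+1}=0} the singular term is interpreted by its continuous extension).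 If u attains its minimum over the closed ball at a boundary point x⁰ ∈ ∂B₁, then either u is constant or −∂u/∂ν (x⁰) > 0, where ν is the outward unit normal to ∂B₁ at x⁰. -/
open MeasureTheory Metric Filter Function Topology

/-- Second-order necessary condition in one variable. -/
lemma aux_deriv2_nonneg {g g' : ℝ → ℝ} {g'' : ℝ} (h1 : ∀ᶠ t in 𝓝 (0 : ℝ), HasDerivAt g (g' t) t)
    (h2 : HasDerivAt g' g'' 0) (hmin : IsLocalMin g 0) : g' 0 = 0 ∧ 0 ≤ g'' := by
  have h0 : HasDerivAt g (g' 0) 0 := h1.self_of_nhds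
  have hd : deriv g =ᶠ[𝓝 0] g' := h1.mono fun t ht => ht.deriv
  have hz : g' 0 = 0 := hmin.hasDerivAt_eq_zero h0
  have hdd : deriv (deriv g) 0 = g'' := by rw [hd.deriv_eq, h2.deriv]
  refine ⟨hz, ?_⟩
  by_contra hneg
  push Not at hneg
  have hmax : IsLocalMax g 0 :=
    isLocalMax_of_deriv_deriv_neg (by rw [hdd]; exact hneg) (by rw [h0.deriv, hz]) h0.continuousAt
  have hconst : g =ᶠ[𝓝 0] fun _ => g 0 := by
    filter_upwards [hmin, hmax] with t ht1 ht2
    exact le_antisymm ht2 ht1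
  have : deriv (deriv g) 0 = 0 := by
    rw [hconst.deriv.deriv_eq]
    simp
  linarith

/-- Touching from below by the Hopf barrier. -/
lemma aux_touch {E : Type*} [NormedAddCommGroup E] [InnerProductSpace ℝ E] {u : E → ℝ} {x y : E}
    {α ε : ℝ} (hu : ContDiffAt ℝ 2 u x)
    (hmin : IsLocalMin (fun p => u p - ε * Real.exp (-α * ‖p - y‖ ^ 2)) x) (ξ : E) :
    fderiv ℝ u x ξ = ε * Real.exp (-α * ‖x - y‖ ^ 2) * (-2 * α * inner ℝ (x - y) ξ) ∧
    ε * Real.exp (-α * ‖x - y‖ ^ 2) * (4 * α ^ 2 * (inner ℝ (x - y) ξ) ^ 2 - 2 * α * ‖ξ‖ ^ 2) ≤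
      fderiv ℝ (fderiv ℝ u) x ξ ξ := by
  set w := x - y with hw
  set β : ℝ := inner ℝ w ξ with hβ
  have hnorm : ∀ t : ℝ, ‖x + t • ξ - y‖ ^ 2 = ‖w‖ ^ 2 + 2 * t * β + t ^ 2 * ‖ξ‖ ^ 2 := by
    intro t
    have : x + t • ξ - y = w + t • ξ := by rw [hw]; abel
    rw [this, norm_add_sq_real, inner_smul_right, norm_smul, mul_pow, Real.norm_eq_abs, sq_abs]
    ring
  have hline : ∀ t : ℝ, HasDerivAt (fun t : ℝ => x + t • ξ) ξ t := by
    intro t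
    simpa using ((hasDerivAt_id t).smul_const ξ).const_add x
  have hcont : Tendsto (fun t : ℝ => x + t • ξ) (𝓝 0) (𝓝 x) := by
    have := (hline 0).continuousAt.tendsto
    simpa using this
  have hev : ∀ᶠ p in 𝓝 x, ContDiffAt ℝ 2 u p := hu.eventually (by simp)
  let q : ℝ → ℝ := fun t => -α * (‖w‖ ^ 2 + 2 * t * β + t ^ 2 * ‖ξ‖ ^ 2)
  let q' : ℝ → ℝ := fun t => -α * (2 * β + 2 * t * ‖ξ‖ ^ 2)
  have hq : ∀ t, HasDerivAt q (q' t) t := by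
    intro t
    have h1 : HasDerivAt (fun t : ℝ => ‖w‖ ^ 2 + 2 * t * β + t ^ 2 * ‖ξ‖ ^ 2)
        (2 * β + 2 * t * ‖ξ‖ ^ 2) t := by
      have a := ((hasDerivAt_id t).const_mul 2).mul_const β
      have b := ((hasDerivAt_pow 2 t).mul_const (‖ξ‖ ^ 2))
      have := (a.const_add (‖w‖ ^ 2)).add b
      refine HasDerivAt.congr_deriv this ?_
      norm_num
    exact h1.const_mul (-α)
  have hq' : HasDerivAt q' (-α * (2 * ‖ξ‖ ^ 2)) 0 := by
    have a := (((hasDerivAt_id (0:ℝ)).const_mul 2).mul_const (‖ξ‖ ^ 2)).const_add (2 * β)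
    have := a.const_mul (-α)
    rw [mul_one] at this
    exact this
  let g : ℝ → ℝ := fun t => u (x + t • ξ) - ε * Real.exp (q t)
  let g' : ℝ → ℝ := fun t => fderiv ℝ u (x + t • ξ) ξ - ε * (Real.exp (q t) * q' t)
  have hg : ∀ᶠ t in 𝓝 (0 : ℝ), HasDerivAt g (g' t) t := by
    filter_upwards [hcont.eventually hev] with t ht
    have h1 := (ht.differentiableAt (by simp)).hasFDerivAt.comp_hasDerivAt t (hline t)
    exact h1.sub ((hq t).exp.const_mul ε)
  have hg2 : HasDerivAt g' (fderiv ℝ (fderiv ℝ u) x ξ ξ -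
      ε * ((Real.exp (q 0) * q' 0) * q' 0 + Real.exp (q 0) * (-α * (2 * ‖ξ‖ ^ 2)))) 0 := by
    have hd : ContDiffAt ℝ 1 (fderiv ℝ u) x := hu.fderiv_right (by norm_num)
    have hd' : HasFDerivAt (fderiv ℝ u) (fderiv ℝ (fderiv ℝ u) x) (x + (0:ℝ) • ξ) := by
      simpa using (hd.differentiableAt (by simp)).hasFDerivAt
    have h1 := hd'.comp_hasDerivAt 0 (hline 0)
    have h2 : HasDerivAt (fun t : ℝ => fderiv ℝ u (x + t • ξ) ξ)
        (fderiv ℝ (fderiv ℝ u) x ξ ξ) 0 := by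
      simpa using h1.clm_apply (hasDerivAt_const (0:ℝ) ξ)
    exact h2.sub (((hq 0).exp.mul hq').const_mul ε)
  have hgmin : IsLocalMin g 0 := by
    have h1 : ∀ᶠ t in 𝓝 (0:ℝ), u x - ε * Real.exp (-α * ‖x - y‖ ^ 2) ≤
        u (x + t • ξ) - ε * Real.exp (-α * ‖x + t • ξ - y‖ ^ 2) := hcont.eventually hmin
    filter_upwards [h1] with t ht
    rw [hnorm t] at ht
    simpa [g, q] using ht
  obtain ⟨r1, r2⟩ := aux_deriv2_nonneg hg hg2 hgmin
  have e0 : q 0 = -α * ‖w‖ ^ 2 := by simp [q]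
  have e1 : q' 0 = -α * (2 * β) := by simp [q']
  have e2 : g' 0 = fderiv ℝ u x ξ - ε * (Real.exp (q 0) * q' 0) := by simp [g']
  rw [e2] at r1
  rw [e0, e1] at r1 r2
  constructor
  · linear_combination r1
  · nlinarith [r2]

lemma aux_pderiv2 {m : ℕ} {u : EuclideanSpace ℝ (Fin m) → ℝ} {x : EuclideanSpace ℝ (Fin m)}
    (hu : ContDiffAt ℝ 2 u x) (i j : Fin m) :
    pderiv' i (pderiv' j u) x = fderiv ℝ (fderiv ℝ u) x (EuclideanSpace.single i 1)
      (EuclideanSpace.single j 1) := by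
  have hd : ContDiffAt ℝ 1 (fderiv ℝ u) x := hu.fderiv_right (by norm_num)
  have h := (hd.differentiableAt (by simp)).hasFDerivAt.clm_apply
    (hasFDerivAt_const (EuclideanSpace.single j (1:ℝ)) x)
  unfold pderiv'
  rw [h.fderiv]
  simp

lemma aux_sum_repr {m : ℕ} (v : EuclideanSpace ℝ (Fin m)) :
    v = ∑ i, v i • EuclideanSpace.single i (1:ℝ) := by
  ext j
  simp [Finset.sum_apply, Pi.single_apply]

lemma aux_inner {m : ℕ} (v w : EuclideanSpace ℝ (Fin m)) : inner ℝ v w = ∑ i, v i * w i := by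
  simp [PiLp.inner_apply, mul_comm]

/-- Lower bound for `opL` at a touching point. -/
lemma aux_opL {n : ℕ}
    {A : EuclideanSpace ℝ (Fin (n + 1)) → Matrix (Fin (n + 1)) (Fin (n + 1)) ℝ}
    {b : EuclideanSpace ℝ (Fin (n + 1)) → Fin n → ℝ}
    {c : EuclideanSpace ℝ (Fin (n + 1)) → ℝ}
    {u : EuclideanSpace ℝ (Fin (n + 1)) → ℝ} {x y : EuclideanSpace ℝ (Fin (n + 1))}
    (hc0 : 0 ≤ c x) (hA : (A x).PosDef) {α ε : ℝ} (hα : 0 < α) (hε : 0 < ε)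
    (hu : ContDiffAt ℝ 2 u x)
    (hxy : 0 ≤ x (Fin.last n) * y (Fin.last n))
    (hmin : IsLocalMin (fun p => u p - ε * Real.exp (-α * ‖p - y‖ ^ 2)) x) :
    ε * Real.exp (-α * ‖x - y‖ ^ 2) * (4 * α ^ 2 * (∑ i, ∑ j, A x i j * ((x - y) i * (x - y) j))
      - 2 * α * ((∑ i, A x i i) + (∑ i : Fin n, b x i * (x - y) (Fin.castSucc i)) + c x))
      ≤ opL n A b c u x := by
  have ht := fun ξ => aux_touch hu hmin ξ
  set w := x - y with hw
  set M := ε * Real.exp (-α * ‖w‖ ^ 2) with hM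
  have hMpos : 0 < M := by positivity
  obtain ⟨N, B, hB⟩ := Matrix.posSemidef_iff_eq_sum_vecMulVec.mp hA.posSemidef
  have hAij : ∀ i j, A x i j = ∑ k, B k i * B k j := by
    intro i j
    rw [hB]
    simp [Matrix.sum_apply, Matrix.vecMulVec_apply]
  set D := fderiv ℝ (fderiv ℝ u) x with hD
  have hsecond : M * (4 * α ^ 2 * (∑ i, ∑ j, A x i j * (w i * w j)) - 2 * α * (∑ i, A x i i)) ≤
      ∑ i, ∑ j, A x i j * pderiv' i (pderiv' j u) x := by
    have e1 : ∑ i, ∑ j, A x i j * pderiv' i (pderiv' j u) x =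
        ∑ k, D (WithLp.toLp 2 (B k)) (WithLp.toLp 2 (B k)) := by
      have : ∀ k, D (WithLp.toLp 2 (B k)) (WithLp.toLp 2 (B k)) = ∑ i, ∑ j, B k i * B k j *
          D (EuclideanSpace.single i 1) (EuclideanSpace.single j 1) := by
        intro k
        conv_lhs => rw [aux_sum_repr (WithLp.toLp 2 (B k))]
        simp only [map_sum, map_smul, _root_.sum_apply, _root_.smul_apply,
          smul_eq_mul, Finset.mul_sum]
        rw [Finset.sum_comm]
        refine Finset.sum_congr rfl fun i _ => Finset.sum_congr rfl fun j _ => ?_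
        ring
      simp only [this, aux_pderiv2 hu, hAij, Finset.sum_mul]
      rw [eq_comm, Finset.sum_comm]
      refine Finset.sum_congr rfl fun i _ => ?_
      rw [Finset.sum_comm]
    have e2 : ∑ i, ∑ j, A x i j * (w i * w j) =
        ∑ k, (inner ℝ w (WithLp.toLp 2 (B k))) ^ 2 := by
      simp only [aux_inner, hAij, sq, Finset.sum_mul, Finset.mul_sum]
      rw [eq_comm, Finset.sum_comm]
      refine Finset.sum_congr rfl fun i _ => ?_
      rw [Finset.sum_comm]
      refine Finset.sum_congr rfl fun i _ => Finset.sum_congr rfl fun j _ => ?_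
      ring
    have e3 : ∑ i, A x i i = ∑ k, ‖(WithLp.toLp 2 (B k) : EuclideanSpace ℝ (Fin (n+1)))‖ ^ 2 := by
      simp only [EuclideanSpace.norm_sq_eq, hAij]
      rw [Finset.sum_comm]
      simp [sq]
    rw [e1, e2, e3, Finset.mul_sum, Finset.mul_sum, ← Finset.sum_sub_distrib, Finset.mul_sum]
    exact Finset.sum_le_sum fun k _ => (ht _).2
  have hfirst : ∀ i, pderiv' i u x = M * (-2 * α * w i) := by
    intro i
    unfold pderiv'
    rw [(ht _).1]
    simp [aux_inner]
  have hb : ∑ i : Fin n, b x i * pderiv' (Fin.castSucc i) u x =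
      M * (-2 * α * ∑ i : Fin n, b x i * w (Fin.castSucc i)) := by
    simp only [hfirst, Finset.mul_sum]
    refine Finset.sum_congr rfl fun i _ => ?_
    ring
  have hs : M * (-2 * α * c x) ≤
      (if x (Fin.last n) = 0 then c x * pderiv' (Fin.last n) (pderiv' (Fin.last n) u) x
     else (c x / x (Fin.last n)) * pderiv' (Fin.last n) u x) := by
    split_ifs with h0
    · rw [aux_pderiv2 hu]
      have h2 := (ht (EuclideanSpace.single (Fin.last n) 1)).2
      rw [PiLp.norm_single] at h2
      have h3 : M * (-2 * α) ≤ M * (4 * α ^ 2 * (inner ℝ w (EuclideanSpace.single (Fin.last n) 1)) ^ 2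
          - 2 * α * ‖(1:ℝ)‖ ^ 2) := by
        apply mul_le_mul_of_nonneg_left _ hMpos.le
        have : 0 ≤ 4 * α ^ 2 * (inner ℝ w (EuclideanSpace.single (Fin.last n) (1:ℝ))) ^ 2 := by
          positivity
        simp only [norm_one]
        linarith
      have := mul_le_mul_of_nonneg_left (h3.trans h2) hc0
      linarith
    · rw [hfirst]
      have hr : w (Fin.last n) / x (Fin.last n) ≤ 1 := by
        have : w (Fin.last n) / x (Fin.last n) =
            1 - (x (Fin.last n) * y (Fin.last n)) / x (Fin.last n) ^ 2 := by
          simp only [hw, PiLp.sub_apply]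
          field_simp
        rw [this]
        have : 0 ≤ (x (Fin.last n) * y (Fin.last n)) / x (Fin.last n) ^ 2 := by positivity
        linarith
      have h4 : c x / x (Fin.last n) * (M * (-2 * α * w (Fin.last n))) =
          -(M * (2 * α * c x) * (w (Fin.last n) / x (Fin.last n))) := by ring
      rw [h4]
      have : 0 ≤ M * (2 * α * c x) := by positivity
      nlinarith
  unfold opL
  rw [hb]
  linarith

/-- Hopf lemma for balls centered on the plane or lying on one side of it. -/
lemma aux_hopf {n : ℕ}
    {A : EuclideanSpace ℝ (Fin (n + 1)) → Matrix (Fin (n + 1)) (Fin (n + 1)) ℝ}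
    {b : EuclideanSpace ℝ (Fin (n + 1)) → Fin n → ℝ}
    {c : EuclideanSpace ℝ (Fin (n + 1)) → ℝ}
    (hA : ∀ i j, Continuous fun x => A x i j)
    (hb : ∀ i, Continuous fun x => b x i)
    (hc : Continuous c) (hc0 : ∀ x, 0 ≤ c x)
    (hposdef : ∀ x, (A x).PosDef)
    {u : EuclideanSpace ℝ (Fin (n + 1)) → ℝ}
    (hu2 : ContDiffOn ℝ 2 u (ball (0 : EuclideanSpace ℝ (Fin (n + 1))) 1))
    (hu1 : ContDiffOn ℝ 1 u (closedBall (0 : EuclideanSpace ℝ (Fin (n + 1))) 1))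
    (hL : ∀ x ∈ ball (0 : EuclideanSpace ℝ (Fin (n + 1))) 1, opL n A b c u x ≤ 0)
    {m : ℝ} (hm : ∀ x ∈ closedBall (0 : EuclideanSpace ℝ (Fin (n + 1))) 1, m ≤ u x)
    {y z : EuclideanSpace ℝ (Fin (n + 1))} {r : ℝ} (hr : 0 < r)
    (hsub : closedBall y r ⊆ closedBall 0 1) (hsubo : ball y r ⊆ ball 0 1)
    (hside : ∀ x ∈ ball y r, 0 ≤ x (Fin.last n) * y (Fin.last n))
    (hgt : ∀ x ∈ ball y r, m < u x) (hz : z ∈ sphere y r) (huz : u z = m) :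
    0 < fderivWithin ℝ u (closedBall 0 1) z (y - z) := by
  classical
  have hucont : ContinuousOn u (closedBall 0 1) := hu1.continuousOn
  let K : Set (EuclideanSpace ℝ (Fin (n + 1))) := closedBall y r \ ball y (r / 2)
  have hK : IsCompact K := (isCompact_closedBall y r).diff isOpen_ball
  have hzn : ‖z - y‖ = r := by simpa [dist_eq_norm] using hz
  have hzK : z ∈ K := by
    refine ⟨sphere_subset_closedBall hz, ?_⟩
    rw [mem_ball, dist_eq_norm, hzn]; linarith
  have hKne : K.Nonempty := ⟨z, hzK⟩
  -- ellipticity lower bound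
  obtain ⟨δ, hδ, hδK⟩ : ∃ δ > 0, ∀ x ∈ K, δ ≤ ∑ i, ∑ j, A x i j * ((x - y) i * (x - y) j) := by
    have hcont : Continuous fun x : EuclideanSpace ℝ (Fin (n + 1)) =>
        ∑ i, ∑ j, A x i j * ((x - y) i * (x - y) j) := by
      refine continuous_finsetSum _ fun i _ => continuous_finsetSum _ fun j _ => ?_
      have := hA i j
      fun_prop
    obtain ⟨p, hp, hpmin⟩ := hK.exists_isMinOn hKne hcont.continuousOn
    refine ⟨_, ?_, fun x hx => hpmin hx⟩
    have hne : (p - y).ofLp ≠ 0 := by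
      intro h0
      have h1 : p - y = 0 := by
        ext i; exact congrFun h0 i
      apply hp.2
      rw [mem_ball, dist_eq_norm, h1, norm_zero]; linarith
    have := (hposdef p).dotProduct_mulVec_pos hne
    refine this.trans_eq ?_
    simp only [dotProduct, Matrix.mulVec, Finset.mul_sum, star_trivial]
    refine Finset.sum_congr rfl fun i _ => Finset.sum_congr rfl fun j _ => ?_
    ring
  obtain ⟨C, hCK⟩ : ∃ C, ∀ x ∈ K,
      (∑ i, A x i i) + (∑ i : Fin n, b x i * (x - y) (Fin.castSucc i)) + c x ≤ C := by
    have hcont : Continuous fun x : EuclideanSpace ℝ (Fin (n + 1)) =>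
        (∑ i, A x i i) + (∑ i : Fin n, b x i * (x - y) (Fin.castSucc i)) + c x := by
      refine ((continuous_finsetSum _ fun i _ => hA i i).add
        (continuous_finsetSum _ fun i _ => ?_)).add hc
      have := hb i
      fun_prop
    obtain ⟨p, hp, hpmax⟩ := hK.exists_isMaxOn hKne hcont.continuousOn
    exact ⟨_, fun x hx => hpmax hx⟩
  let α : ℝ := (|C| + 1) / δ
  have hα : 0 < α := by positivity
  have hαC : 0 < 4 * α ^ 2 * δ - 2 * α * C := by
    have h1 : α * δ = |C| + 1 := by simp only [α]; field_simp
    have h2 : 4 * α ^ 2 * δ - 2 * α * C = 2 * α * (2 * (α * δ) - C) := by ring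
    rw [h2, h1]
    have := le_abs_self C
    have := abs_nonneg C
    apply mul_pos (by positivity)
    linarith
  -- inner sphere
  obtain ⟨ε, hε, hεS⟩ : ∃ ε > 0, ∀ x ∈ sphere y (r / 2), m + ε ≤ u x := by
    by_cases hS : (sphere y (r / 2)).Nonempty
    · have hSb : sphere y (r / 2) ⊆ ball y r := fun x hx => by
        rw [mem_sphere] at hx; rw [mem_ball, hx]; linarith
      obtain ⟨p, hp, hpmin⟩ := (isCompact_sphere y (r / 2)).exists_isMinOn hS
        (hucont.mono (hSb.trans (ball_subset_closedBall.trans hsub)))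
      refine ⟨u p - m, sub_pos.2 (hgt p (hSb hp)), fun x hx => ?_⟩
      have : u p ≤ u x := hpmin hx
      linarith
    · exact ⟨1, one_pos, fun x hx => (hS ⟨x, hx⟩).elim⟩
  let v : EuclideanSpace ℝ (Fin (n + 1)) → ℝ := fun p => u p - ε * Real.exp (-α * ‖p - y‖ ^ 2)
  have hvcont : ContinuousOn v K := by
    refine (hucont.mono (fun x hx => hsub hx.1)).sub (Continuous.continuousOn ?_)
    fun_prop
  have hcomp : ∀ x ∈ K, m - ε * Real.exp (-α * r ^ 2) ≤ v x := by
    obtain ⟨p, hp, hpmin⟩ := hK.exists_isMinOn hKne hvcont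
    intro x hx
    refine le_trans ?_ (hpmin hx)
    have hp1 : ‖p - y‖ ≤ r := by simpa [dist_eq_norm] using hp.1
    have hp2 : r / 2 ≤ ‖p - y‖ := by simpa [dist_eq_norm] using hp.2
    rcases hp1.eq_or_lt with h1 | h1
    · change _ ≤ u p - ε * Real.exp (-α * ‖p - y‖ ^ 2)
      rw [h1]
      have := hm p (hsub hp.1)
      linarith
    rcases hp2.eq_or_lt with h2 | h2
    · change _ ≤ u p - ε * Real.exp (-α * ‖p - y‖ ^ 2)
      have h3 := hεS p (by rw [mem_sphere, dist_eq_norm]; exact h2.symm)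
      have h4 : Real.exp (-α * ‖p - y‖ ^ 2) ≤ 1 := by
        apply Real.exp_le_one_iff.2
        have : 0 ≤ α * ‖p - y‖ ^ 2 := by positivity
        linarith
      have h5 := Real.exp_pos (-α * r ^ 2)
      nlinarith
    · exfalso
      have hpb : p ∈ ball y r := by rw [mem_ball, dist_eq_norm]; exact h1
      have hKn : K ∈ 𝓝 p := by
        have ho : IsOpen (ball y r ∩ (closedBall y (r / 2))ᶜ) :=
          isOpen_ball.inter isClosed_closedBall.isOpen_compl
        refine mem_of_superset (ho.mem_nhds ⟨hpb, ?_⟩) ?_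
        · rw [Set.mem_compl_iff, mem_closedBall, dist_eq_norm]; linarith
        · rintro q ⟨hq1, hq2⟩
          exact ⟨ball_subset_closedBall hq1, fun hq => hq2 (ball_subset_closedBall hq)⟩
      have hloc : IsLocalMin v p := hpmin.isLocalMin hKn
      have hcd : ContDiffAt ℝ 2 u p := hu2.contDiffAt (isOpen_ball.mem_nhds (hsubo hpb))
      have h6 := aux_opL (A := A) (b := b) (c := c) (hc0 p) (hposdef p) hα hε hcd
        (hside p hpb) hloc
      have h7 := hL p (hsubo hpb)
      have h8 := hδK p hp
      have h9 := hCK p hp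
      have h10 : 0 < ε * Real.exp (-α * ‖p - y‖ ^ 2) := by positivity
      have h11 : 4 * α ^ 2 * δ ≤
          4 * α ^ 2 * (∑ i, ∑ j, A p i j * ((p - y) i * (p - y) j)) :=
        mul_le_mul_of_nonneg_left h8 (by positivity)
      have h12 := mul_le_mul_of_nonneg_left h9 (show 0 ≤ 2 * α by positivity)
      have := mul_pos h10 (show 0 < 4 * α ^ 2 * (∑ i, ∑ j, A p i j * ((p - y) i * (p - y) j)) -
        2 * α * ((∑ i, A p i i) + (∑ i : Fin n, b p i * (p - y) (Fin.castSucc i)) + c p) by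
          linarith)
      linarith
  -- derivative along the radius
  let γ : ℝ → EuclideanSpace ℝ (Fin (n + 1)) := fun t => z + t • (y - z)
  have hγn : ∀ t : ℝ, t ≤ 1 → ‖γ t - y‖ = (1 - t) * r := by
    intro t ht
    have : γ t - y = (1 - t) • (z - y) := by
      simp only [γ, sub_smul, one_smul, smul_sub]; abel
    rw [this, norm_smul, hzn, Real.norm_eq_abs, abs_of_nonneg (by linarith)]
  have hγK : ∀ t ∈ Set.Ioc (0:ℝ) (1 / 2), γ t ∈ K := by
    intro t ht
    have := hγn t (by linarith [ht.2])
    refine ⟨?_, ?_⟩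
    · rw [mem_closedBall, dist_eq_norm, this]; nlinarith [ht.1]
    · rw [mem_ball, dist_eq_norm, this]; nlinarith [ht.2]
  have hγd : HasDerivAt γ (y - z) 0 := by
    have := ((hasDerivAt_id (0:ℝ)).smul_const (y - z)).const_add z
    rw [one_smul] at this
    exact this
  have hγ0 : γ 0 = z := by simp [γ]
  have hud : HasFDerivWithinAt u (fderivWithin ℝ u (closedBall 0 1) z) (closedBall 0 1) (γ 0) := by
    rw [hγ0]
    exact ((hu1.differentiableOn (by simp)) z (hsub hzK.1)).hasFDerivWithinAt
  have hd1 : HasDerivWithinAt (fun t => u (γ t)) (fderivWithin ℝ u (closedBall 0 1) z (y - z))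
      (Set.Ioc 0 (1 / 2)) 0 :=
    hud.comp_hasDerivWithinAt 0 hγd.hasDerivWithinAt (fun t ht => hsub (hγK t ht).1)
  have hd2 : HasDerivAt (fun t : ℝ => ε * Real.exp (-α * ((1 - t) * r) ^ 2))
      (ε * (Real.exp (-α * r ^ 2) * (2 * α * r ^ 2))) 0 := by
    have a : HasDerivAt (fun t : ℝ => (1 - t) * r) (-1 * r) 0 :=
      ((hasDerivAt_id (0:ℝ)).const_sub 1).mul_const r
    have a2 := (((a.pow 2).const_mul (-α)).exp).const_mul ε
    refine HasDerivAt.congr_deriv a2 ?_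
    simp only [Pi.pow_apply, sub_zero, one_mul, Nat.cast_ofNat]
    ring
  have hd := hd1.sub hd2.hasDerivWithinAt
  rw [hasDerivWithinAt_iff_tendsto_slope' (by simp)] at hd
  have hne : (𝓝[Set.Ioc (0:ℝ) (1 / 2)] 0).NeBot := by
    rw [nhdsWithin_Ioc_eq_nhdsGT (by norm_num)]; infer_instance
  have hge : 0 ≤ fderivWithin ℝ u (closedBall 0 1) z (y - z) -
      ε * (Real.exp (-α * r ^ 2) * (2 * α * r ^ 2)) := by
    refine ge_of_tendsto hd ?_
    filter_upwards [self_mem_nhdsWithin] with t ht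
    have h1 := hcomp _ (hγK t ht)
    simp only [v] at h1
    rw [hγn t (by linarith [ht.2])] at h1
    rw [slope_def_field]
    apply div_nonneg _ (by linarith [ht.1])
    simp only [Pi.sub_apply, hγ0, huz, sub_zero, one_mul]
    linarith
  have : 0 < ε * (Real.exp (-α * r ^ 2) * (2 * α * r ^ 2)) := by positivity
  linarith

/-- Strong maximum principle: an interior minimum forces constancy. -/
lemma aux_smp {n : ℕ}
    {A : EuclideanSpace ℝ (Fin (n + 1)) → Matrix (Fin (n + 1)) (Fin (n + 1)) ℝ}
    {b : EuclideanSpace ℝ (Fin (n + 1)) → Fin n → ℝ}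
    {c : EuclideanSpace ℝ (Fin (n + 1)) → ℝ}
    (hA : ∀ i j, Continuous fun x => A x i j)
    (hb : ∀ i, Continuous fun x => b x i)
    (hc : Continuous c) (hc0 : ∀ x, 0 ≤ c x)
    (hposdef : ∀ x, (A x).PosDef)
    {u : EuclideanSpace ℝ (Fin (n + 1)) → ℝ}
    (hu2 : ContDiffOn ℝ 2 u (ball (0 : EuclideanSpace ℝ (Fin (n + 1))) 1))
    (hu1 : ContDiffOn ℝ 1 u (closedBall (0 : EuclideanSpace ℝ (Fin (n + 1))) 1))
    (hL : ∀ x ∈ ball (0 : EuclideanSpace ℝ (Fin (n + 1))) 1, opL n A b c u x ≤ 0)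
    {m : ℝ} (hm : ∀ x ∈ closedBall (0 : EuclideanSpace ℝ (Fin (n + 1))) 1, m ≤ u x)
    {p : EuclideanSpace ℝ (Fin (n + 1))} (hp : p ∈ ball 0 1) (hup : u p = m) :
    ∀ x ∈ ball (0 : EuclideanSpace ℝ (Fin (n + 1))) 1, u x = m := by
  let F : Set (EuclideanSpace ℝ (Fin (n + 1))) := closedBall 0 1 ∩ u ⁻¹' {m}
  have hF : IsClosed F := hu1.continuousOn.preimage_isClosed_of_isClosed isClosed_closedBall
    isClosed_singleton
  have hbF : ∀ x ∈ ball (0 : EuclideanSpace ℝ (Fin (n + 1))) 1, x ∉ F → m < u x := by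
    intro x hx hxF
    have hx' := ball_subset_closedBall hx
    exact lt_of_le_of_ne (hm x hx') fun h => hxF ⟨hx', h.symm⟩
  have key : ∀ (y z : EuclideanSpace ℝ (Fin (n + 1))) (r : ℝ), 0 < r → closedBall y r ⊆ ball 0 1 →
      (∀ x ∈ ball y r, 0 ≤ x (Fin.last n) * y (Fin.last n)) → (∀ x ∈ ball y r, m < u x) →
      z ∈ sphere y r → u z = m → False := by
    intro y z r hr hsub hside hgt hz huz
    have h := aux_hopf hA hb hc hc0 hposdef hu2 hu1 hL hm hr (hsub.trans ball_subset_closedBall)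
      (ball_subset_closedBall.trans hsub) hside hgt hz huz
    have hzb : closedBall (0 : EuclideanSpace ℝ (Fin (n + 1))) 1 ∈ 𝓝 z :=
      mem_of_superset (isOpen_ball.mem_nhds (hsub (sphere_subset_closedBall hz)))
        ball_subset_closedBall
    have hloc : IsLocalMin u z := by
      filter_upwards [hzb] with x hx
      rw [huz]; exact hm x hx
    rw [fderivWithin_of_mem_nhds hzb, hloc.fderiv_eq_zero] at h
    simp at h
  let U : ℝ → Set (EuclideanSpace ℝ (Fin (n + 1))) := fun σ =>
    ball 0 1 ∩ {x | 0 < σ * x (Fin.last n)}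
  have hUo : ∀ σ, IsOpen (U σ) := fun σ => isOpen_ball.inter
    (isOpen_lt continuous_const (by fun_prop))
  have hUside : ∀ σ, ∀ x ∈ U σ, ∀ y ∈ U σ, 0 ≤ x (Fin.last n) * y (Fin.last n) := by
    rintro σ x ⟨-, hx⟩ y ⟨-, hy⟩
    have hx : 0 < σ * x (Fin.last n) := hx
    have hy : 0 < σ * y (Fin.last n) := hy
    by_contra hneg
    push Not at hneg
    have := mul_pos hx hy
    nlinarith [sq_nonneg σ]
  have half : ∀ σ, ∀ q ∈ U σ, u q = m → U σ ⊆ F := by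
    intro σ q hq huq
    have hpre : IsPreconnected (U σ) := by
      apply Convex.isPreconnected
      refine (convex_ball _ _).inter (convex_halfSpace_gt ⟨?_, ?_⟩ 0)
      · intro x y; simp [mul_add]
      · intro a x; simp; ring
    have hT : IsOpen (U σ ∩ F) := by
      rw [Metric.isOpen_iff]
      rintro q ⟨hq, hqF⟩
      obtain ⟨d, hd, hdU⟩ := Metric.isOpen_iff.1 (hUo σ) q hq
      refine ⟨d / 2, by positivity, fun y hy => ?_⟩
      rw [mem_ball] at hy
      have hyU : y ∈ U σ := hdU (by rw [mem_ball]; linarith)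
      refine ⟨hyU, ?_⟩
      by_contra hyF
      obtain ⟨z, hzF, hz⟩ := hF.exists_infDist_eq_dist ⟨q, hqF⟩ y
      have hle : dist y z ≤ dist y q := hz ▸ infDist_le_dist_of_mem hqF
      have hpos : 0 < dist y z := dist_pos.2 fun h => hyF (h ▸ hzF)
      have hsubU : closedBall y (dist y z) ⊆ U σ := by
        intro x hx
        apply hdU
        rw [mem_closedBall] at hx
        rw [mem_ball]
        have := dist_triangle x y q
        linarith
      refine key y z (dist y z) hpos (fun x hx => (hsubU hx).1)
        (fun x hx => hUside σ x (hsubU (ball_subset_closedBall hx)) y hyU) ?_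
        (by rw [mem_sphere, dist_comm]) hzF.2
      intro x hx
      refine hbF x (hsubU (ball_subset_closedBall hx)).1 ?_
      rw [← hz] at hx
      exact ball_infDist_subset_compl hx
    have := hpre.subset_of_closure_inter_subset hT
      ⟨q, hq, hq, ball_subset_closedBall hq.1, huq⟩ (fun x hx => ⟨hx.2,
        (hF.closure_subset_iff.2 Set.inter_subset_right) hx.1⟩)
    exact this.trans Set.inter_subset_right
  have plane : ∀ σ : ℝ, (σ = 1 ∨ σ = -1) → ∀ q ∈ ball (0 : EuclideanSpace ℝ (Fin (n + 1))) 1,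
      q (Fin.last n) = 0 → u q = m → U σ ⊆ F := by
    intro σ hσ q hq hq0 huq
    by_cases hex : ∃ q' ∈ U σ, u q' = m
    · obtain ⟨q', h1, h2⟩ := hex
      exact half σ q' h1 h2
    exfalso
    push Not at hex
    obtain ⟨d, hd, hdU⟩ := Metric.isOpen_iff.1 isOpen_ball q hq
    have hσ2 : σ * σ = 1 := by rcases hσ with h | h <;> rw [h] <;> norm_num
    have hσa : |σ| = 1 := by rcases hσ with h | h <;> rw [h] <;> norm_num
    let y : EuclideanSpace ℝ (Fin (n + 1)) := q + (σ * (d / 3)) • EuclideanSpace.single (Fin.last n) 1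
    have hyq : dist q y = d / 3 := by
      simp only [y]
      rw [dist_eq_norm, sub_add_cancel_left, norm_neg, norm_smul, PiLp.norm_single,
        norm_one, mul_one, Real.norm_eq_abs, abs_mul, hσa, one_mul, abs_of_pos (by positivity)]
    have hylast : y (Fin.last n) = σ * (d / 3) := by simp [y, hq0]
    have hsub : closedBall y (d / 3) ⊆ ball 0 1 := by
      intro x hx
      apply hdU
      rw [mem_closedBall] at hx
      rw [mem_ball]
      have := dist_triangle x y q
      rw [dist_comm y q] at this
      linarith
    have hsubU : ball y (d / 3) ⊆ U σ := by
      intro x hx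
      refine ⟨hsub (ball_subset_closedBall hx), ?_⟩
      rw [mem_ball, dist_eq_norm] at hx
      have h1 := (PiLp.norm_apply_le (x - y) (Fin.last n)).trans_lt hx
      rw [PiLp.sub_apply, hylast, Real.norm_eq_abs] at h1
      have h2 : |σ * (x (Fin.last n) - σ * (d / 3))| < d / 3 := by
        rw [abs_mul, hσa, one_mul]; exact h1
      have h3 := (abs_lt.1 h2).1
      have h4 : σ * (x (Fin.last n) - σ * (d / 3)) = σ * x (Fin.last n) - d / 3 := by
        linear_combination (-(d / 3)) * hσ2
      rw [h4] at h3
      change 0 < σ * x (Fin.last n)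
      linarith
    refine key y q (d / 3) (by positivity) hsub (fun x hx => hUside σ x (hsubU hx) y
      (hsubU (mem_ball_self (by positivity)))) (fun x hx => ?_) hyq huq
    exact lt_of_le_of_ne (hm x (ball_subset_closedBall (hsubU hx).1)) (hex x (hsubU hx)).symm
  have clos : ∀ σ : ℝ, (σ = 1 ∨ σ = -1) → U σ ⊆ F →
      ∀ q ∈ ball (0 : EuclideanSpace ℝ (Fin (n + 1))) 1, q (Fin.last n) = 0 → q ∈ F := by
    intro σ hσ hUF q hq hq0
    have hσ2 : σ * σ = 1 := by rcases hσ with h | h <;> rw [h] <;> norm_num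
    have hlim : Tendsto (fun t : ℝ => q + (σ * t) • EuclideanSpace.single (Fin.last n) (1:ℝ))
        (𝓝[>] 0) (𝓝 q) := by
      have : Continuous fun t : ℝ => q + (σ * t) • EuclideanSpace.single (Fin.last n) (1:ℝ) := by
        fun_prop
      have h := this.tendsto 0
      simp only [mul_zero, zero_smul, add_zero] at h
      exact h.mono_left nhdsWithin_le_nhds
    refine hF.mem_of_tendsto hlim ?_
    filter_upwards [self_mem_nhdsWithin, hlim.eventually (isOpen_ball.mem_nhds hq)] with t ht htb
    apply hUF
    refine ⟨htb, ?_⟩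
    have ht : 0 < t := ht
    have e : σ * (σ * t) = t := by linear_combination t * hσ2
    simp [hq0, e, ht]
  have h0b : (0 : EuclideanSpace ℝ (Fin (n + 1))) ∈ ball 0 1 := mem_ball_self one_pos
  have hU : ∃ σ : ℝ, (σ = 1 ∨ σ = -1) ∧ U σ ⊆ F := by
    rcases lt_trichotomy (p (Fin.last n)) 0 with h | h | h
    · exact ⟨-1, Or.inr rfl, half (-1) p ⟨hp, by simpa using h⟩ hup⟩
    · exact ⟨1, Or.inl rfl, plane 1 (Or.inl rfl) p hp h hup⟩
    · exact ⟨1, Or.inl rfl, half 1 p ⟨hp, by simpa using h⟩ hup⟩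
  obtain ⟨σ, hσ, hσF⟩ := hU
  have h0F := (clos σ hσ hσF 0 h0b (by simp)).2
  intro x hx
  rcases lt_trichotomy (x (Fin.last n)) 0 with h | h | h
  · exact (plane (-1) (Or.inr rfl) 0 h0b (by simp) h0F ⟨hx, by simpa using h⟩).2
  · exact (clos σ hσ hσF x hx h).2
  · exact (plane 1 (Or.inl rfl) 0 h0b (by simp) h0F ⟨hx, by simpa using h⟩).2

theorem stmt_6 (n : ℕ)
    (A : EuclideanSpace ℝ (Fin (n + 1)) → Matrix (Fin (n + 1)) (Fin (n + 1)) ℝ)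
    (b : EuclideanSpace ℝ (Fin (n + 1)) → Fin n → ℝ)
    (c : EuclideanSpace ℝ (Fin (n + 1)) → ℝ)
    (hA : ∀ i j, Continuous fun x => A x i j)
    (hb : ∀ i, Continuous fun x => b x i)
    (hc : Continuous c) (hc0 : ∀ x, 0 ≤ c x)
    (hposdef : ∀ x, (A x).PosDef)
    (u : EuclideanSpace ℝ (Fin (n + 1)) → ℝ)
    (hu2 : ContDiffOn ℝ 2 u (ball (0 : EuclideanSpace ℝ (Fin (n + 1))) 1))
    (hu1 : ContDiffOn ℝ 1 u (closedBall (0 : EuclideanSpace ℝ (Fin (n + 1))) 1))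
    (hbd : ∀ x ∈ ball (0 : EuclideanSpace ℝ (Fin (n + 1))) 1, x (Fin.last n) = 0 →
      pderiv' (Fin.last n) u x = 0)
    (hL : ∀ x ∈ ball (0 : EuclideanSpace ℝ (Fin (n + 1))) 1, opL n A b c u x ≤ 0)
    (x₀ : EuclideanSpace ℝ (Fin (n + 1))) (hx₀ : x₀ ∈ sphere (0 : EuclideanSpace ℝ (Fin (n + 1))) 1)
    (hmin : IsMinOn u (closedBall (0 : EuclideanSpace ℝ (Fin (n + 1))) 1) x₀) :
    (∃ k : ℝ, ∀ x ∈ closedBall (0 : EuclideanSpace ℝ (Fin (n + 1))) 1, u x = k) ∨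
      0 < -(fderivWithin ℝ u (closedBall (0 : EuclideanSpace ℝ (Fin (n + 1))) 1) x₀ x₀) := by

  have hm : ∀ x ∈ closedBall (0 : EuclideanSpace ℝ (Fin (n + 1))) 1, u x₀ ≤ u x :=
    fun x hx => hmin hx
  by_cases hex : ∃ p ∈ ball (0 : EuclideanSpace ℝ (Fin (n + 1))) 1, u p = u x₀
  · left
    obtain ⟨p, hp, hup⟩ := hex
    have h := aux_smp hA hb hc hc0 hposdef hu2 hu1 hL hm hp hup
    refine ⟨u x₀, ?_⟩
    have hE : Set.EqOn u (fun _ => u x₀) (ball 0 1) := h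
    exact hE.of_subset_closure hu1.continuousOn continuousOn_const ball_subset_closedBall
      (closure_ball (0 : EuclideanSpace ℝ (Fin (n + 1))) one_ne_zero).ge
  · right
    push Not at hex
    have h := aux_hopf hA hb hc hc0 hposdef hu2 hu1 hL hm one_pos subset_rfl subset_rfl
      (by simp) (fun x hx => lt_of_le_of_ne (hm x (ball_subset_closedBall hx)) (hex x hx).symm)
      hx₀ rfl
    rw [zero_sub, map_neg] at h
    exact h
end
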